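/- With φ_{i,j} and τ_n^{i,j} as in the context, for every integer n ≥ 0 the pair q = −((c−a−1)/(c−a))^n τ_n^{1,0}τ_{n+1}^{0,1}/(τ_n^{0,0}τ_{n+1}^{1,1}) and p = −(a/(c−a−1))·(1/t)·τ_n^{0,0}τ_{n+1}^{1,1}τ_{n−1}^{2,1}/((τ_n^{1,1})² τ_n^{1,0}) gives a solution of the Hamiltonian system S_V with parameters κ∞ = a+n, κ₀ = c−a, θ = −c+n, on every open subinterval of (0,∞) on which none of the τ-functions appearing in the denominators vanishes. -/

import Mathlib

open scoped Real

/-- Kummer's confluent hypergeometric function `F(a,c;t)` as an everywhere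
convergent power series. -/
noncomputable def kummerF (a c : ℂ) (t : ℝ) : ℂ :=
  ∑' n : ℕ, (Polynomial.eval a (ascPochhammer ℂ n) /
    (Polynomial.eval c (ascPochhammer ℂ n) * (n.factorial : ℂ))) * (t : ℂ) ^ n

/-- The seed functions `φ_{i,j}`. -/
noncomputable def phiV (a c c₁ c₂ : ℂ) (i j : ℤ) (t : ℝ) : ℂ :=
  c₁ * (Complex.Gamma (a + i) * Complex.Gamma (c - a - i + j) / Complex.Gamma (c + j)) *
      kummerF (a + i) (c + j) t
  + c₂ * (1 / (Complex.sin ((π : ℂ) * (c - a - i + j)) * Complex.Gamma (2 - c - j))) *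
      ((t : ℂ) ^ (1 - c - (j : ℂ)) * kummerF (a - c + 1 + i - j) (2 - c - j) t)

/-- The Euler derivation `δ = t d/dt`. -/
noncomputable def eulerD (f : ℝ → ℂ) : ℝ → ℂ := fun t => (t : ℂ) * deriv f t

/-- The Hankel determinants `τ_n^{i,j} = det((t d/dt)^{k+l} φ_{i,j})_{0≤k,l≤n-1}`,
extended by `0` to negative indices `n`. -/
noncomputable def tauV (a c c₁ c₂ : ℂ) (i j : ℤ) (m : ℤ) (t : ℝ) : ℂ :=
  if m < 0 then 0
  else Matrix.det (Matrix.of fun k l : Fin m.toNat =>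
    eulerD^[(k : ℕ) + (l : ℕ)] (phiV a c c₁ c₂ i j) t)

open Matrix in
/-- The three-term Plücker relation, for two rows of a square matrix replaced by arbitrary vectors. -/
theorem Matrix.det_mul_det_updateRow_updateRow {ι R : Type*} [Fintype ι] [DecidableEq ι]
    [CommRing R] (A : Matrix ι ι R) {i j : ι} (hij : i ≠ j) (u v : ι → R) :
    A.det * ((A.updateRow j v).updateRow i u).det =
      (A.updateRow i u).det * (A.updateRow j v).det -
        (A.updateRow j u).det * (A.updateRow i v).det := by
  have hu : A.det • u = ∑ k, (A.updateRow k u).det • A k := by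
    have h := mulVec_cramer Aᵀ u
    rw [det_transpose] at h
    rw [← h]
    ext l
    simp [mulVec, dotProduct, cramer_transpose_apply, mul_comm]
  have hlin : A.det * ((A.updateRow j v).updateRow i u).det =
      ∑ k, (A.updateRow k u).det * ((A.updateRow j v).updateRow i (A k)).det := by
    rw [← det_updateRow_smul, hu]
    have := map_sum (detRowAlternating.toMultilinearMap.toLinearMap (A.updateRow j v) i)
      (fun k => (A.updateRow k u).det • A k) Finset.univ
    simp only [map_smul, smul_eq_mul] at this
    exact this
  rw [hlin, ← Finset.add_sum_erase _ _ (Finset.mem_univ i),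
    ← Finset.add_sum_erase _ _ (Finset.mem_erase.2 ⟨hij.symm, Finset.mem_univ j⟩),
    Finset.sum_eq_zero, add_zero, sub_eq_add_neg, ← mul_neg]
  · congr 2
    · congr 1
      ext k l
      by_cases hk : k = i
      · subst hk; simp [updateRow_apply, hij]
      · simp [updateRow_apply, hk]
    · refine Eq.trans ?_ (detRowAlternating.map_swap (A.updateRow i v) hij)
      congr 1
      ext k l
      change _ = A.updateRow i v (Equiv.swap i j k) l
      by_cases hk : k = i
      · subst hk; simp [updateRow_apply, hij.symm]
      · by_cases hk' : k = j
        · subst hk'; simp [updateRow_apply, hk]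
        · simp [updateRow_apply, hk, hk', Equiv.swap_apply_of_ne_of_ne hk hk']
  · intro k hk
    simp only [Finset.mem_erase, Finset.mem_univ, and_true] at hk
    rw [det_zero_of_row_eq (M := (A.updateRow j v).updateRow i (A k)) (Ne.symm hk.2)]
    · exact mul_zero _
    · ext l
      simp [updateRow_apply, hk.1, hk.2]

/-- The Hankel determinant `det (m (i + j))` of size `N`. -/
noncomputable def hankelDet (N : ℕ) (m : ℕ → ℂ) : ℂ :=
  (Matrix.of fun i j : Fin N => m (i + j)).det

/-- The `N + 1` by `N + 1` Hankel determinant of `m` with its last row replaced by `x`. -/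
noncomputable def hankelDet₁ (N : ℕ) (m x : ℕ → ℂ) : ℂ :=
  (Matrix.of fun i j : Fin (N + 1) => if (i : ℕ) < N then m (i + j) else x j).det

/-- The `N + 2` by `N + 2` Hankel determinant of `m` with its last two rows replaced by `x`, `y`. -/
noncomputable def hankelDet₂ (N : ℕ) (m x y : ℕ → ℂ) : ℂ :=
  (Matrix.of fun i j : Fin (N + 2) =>
    if (i : ℕ) < N then m (i + j) else if (i : ℕ) = N then x j else y j).det

/-- The Hankel determinant of `m` of size `N - 1`, with value `0` for `N = 0`. -/
noncomputable def hankelDetPred : ℕ → (ℕ → ℂ) → ℂ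
  | 0, _ => 0
  | N + 1, m => hankelDet N m

/-- The Hankel determinant of `m` with its last row shifted by one. -/
noncomputable def hankelDetShift : ℕ → (ℕ → ℂ) → ℂ
  | 0, _ => 0
  | N + 1, m => hankelDet₁ N m fun j => m (N + 1 + j)

/-- The determinant `hankelDetShift` of size `N - 1`, with value `0` for `N = 0`. -/
noncomputable def hankelDetShiftPred : ℕ → (ℕ → ℂ) → ℂ
  | 0, _ => 0
  | N + 1, m => hankelDetShift N m

/-- The Christoffel transform of a moment sequence: the measure is multiplied by `x + α`. -/
def christoffel (α : ℂ) (m : ℕ → ℂ) : ℕ → ℂ := fun k => m (k + 1) + α * m k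

theorem christoffel_comm (α β : ℂ) (m : ℕ → ℂ) :
    christoffel α (christoffel β m) = christoffel β (christoffel α m) := by
  funext k
  simp only [christoffel]
  ring

theorem christoffel_shift (α : ℂ) (N : ℕ) (m : ℕ → ℂ) :
    christoffel α (fun j => m (N + j)) = fun j => christoffel α m (N + j) := rfl

theorem hankelDet₁_self (N : ℕ) (m : ℕ → ℂ) :
    hankelDet₁ N m (fun j => m (N + j)) = hankelDet (N + 1) m := by
  unfold hankelDet₁ hankelDet
  congr 1
  ext i j
  have := i.isLt
  by_cases h : (i : ℕ) < N
  · simp [h]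
  · simp [show (i : ℕ) = N by omega]

theorem hankelDet₂_self (N : ℕ) (m y : ℕ → ℂ) :
    hankelDet₂ N m (fun j => m (N + j)) y = hankelDet₁ (N + 1) m y := by
  unfold hankelDet₁ hankelDet₂
  congr 1
  ext i j
  simp only [Matrix.of_apply]
  split_ifs <;> first | rfl | omega | skip
  rw [‹(i : ℕ) = N›]

theorem hankelDet₁_congr {N : ℕ} {m x y : ℕ → ℂ} (h : ∀ j ≤ N, x j = y j) :
    hankelDet₁ N m x = hankelDet₁ N m y := by
  unfold hankelDet₁
  congr 1
  ext i j
  simp [h j (by omega)]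

theorem hankelDet₁_eq_updateRow (N : ℕ) (m x : ℕ → ℂ) : hankelDet₁ N m x =
    ((Matrix.of fun i j : Fin (N + 1) => if (i : ℕ) < N then m (i + j) else 0).updateRow
      (Fin.last N) fun j => x j).det := by
  unfold hankelDet₁
  congr 1
  ext i j
  rw [Matrix.updateRow_apply]
  have := i.isLt
  by_cases h : (i : ℕ) < N
  · simp [h, Fin.ext_iff, h.ne]
  · simp [Fin.ext_iff, show (i : ℕ) = N by omega]

theorem hankelDet₁_add_smul (N : ℕ) (m x y : ℕ → ℂ) (κ : ℂ) :
    hankelDet₁ N m (fun j => x j + κ * y j) = hankelDet₁ N m x + κ * hankelDet₁ N m y := by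
  simp only [hankelDet₁_eq_updateRow, ← Matrix.det_updateRow_smul, ← Matrix.det_updateRow_add]
  rfl

theorem hankelDet₂_updateRow_fst (N : ℕ) (m x y z : ℕ → ℂ) :
    ((Matrix.of fun i j : Fin (N + 2) =>
      if (i : ℕ) < N then m (i + j) else if (i : ℕ) = N then x j else y j).updateRow
        (Fin.last N).castSucc fun j => z j) =
    Matrix.of fun i j : Fin (N + 2) =>
      if (i : ℕ) < N then m (i + j) else if (i : ℕ) = N then z j else y j := by
  ext i j
  rw [Matrix.updateRow_apply]
  simp only [Matrix.of_apply, Fin.ext_iff, Fin.val_castSucc, Fin.val_last]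
  split_ifs <;> first | rfl | omega

theorem hankelDet₂_updateRow_snd (N : ℕ) (m x y z : ℕ → ℂ) :
    ((Matrix.of fun i j : Fin (N + 2) =>
      if (i : ℕ) < N then m (i + j) else if (i : ℕ) = N then x j else y j).updateRow
        (Fin.last (N + 1)) fun j => z j) =
    Matrix.of fun i j : Fin (N + 2) =>
      if (i : ℕ) < N then m (i + j) else if (i : ℕ) = N then x j else z j := by
  ext i j
  rw [Matrix.updateRow_apply]
  simp only [Matrix.of_apply, Fin.ext_iff, Fin.val_last]
  split_ifs <;> first | rfl | omega

theorem hankelDet₂_swap (N : ℕ) (m x y : ℕ → ℂ) :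
    hankelDet₂ N m y x = -hankelDet₂ N m x y := by
  have hne : (Fin.last N).castSucc ≠ Fin.last (N + 1) := by simp [Fin.ext_iff]
  refine Eq.trans ?_ (Matrix.detRowAlternating.map_swap (Matrix.of fun i j : Fin (N + 2) =>
    if (i : ℕ) < N then m (i + j) else if (i : ℕ) = N then x j else y j) hne)
  unfold hankelDet₂
  change Matrix.detRowAlternating _ = _
  congr 1
  ext i j
  change _ = Matrix.of (fun i j : Fin (N + 2) =>
    if (i : ℕ) < N then m (i + j) else if (i : ℕ) = N then x j else y j)
      (Equiv.swap (Fin.last N).castSucc (Fin.last (N + 1)) i) j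
  have := i.isLt
  by_cases h : (i : ℕ) < N
  · rw [Equiv.swap_apply_of_ne_of_ne] <;> simp [Fin.ext_iff, h] <;> omega
  · by_cases h' : (i : ℕ) = N
    · rw [show i = (Fin.last N).castSucc by simp [Fin.ext_iff, h'], Equiv.swap_apply_left]
      simp
    · rw [show i = Fin.last (N + 1) by simp [Fin.ext_iff]; omega, Equiv.swap_apply_right]
      simp

theorem hankelDet₂_plucker (N : ℕ) (m x y z w : ℕ → ℂ) :
    hankelDet₂ N m x y * hankelDet₂ N m z w - hankelDet₂ N m x z * hankelDet₂ N m y w +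
      hankelDet₂ N m x w * hankelDet₂ N m y z = 0 := by
  have hne : (Fin.last N).castSucc ≠ Fin.last (N + 1) := by simp [Fin.ext_iff]
  have h := Matrix.det_mul_det_updateRow_updateRow (Matrix.of fun i j : Fin (N + 2) =>
    if (i : ℕ) < N then m (i + j) else if (i : ℕ) = N then x j else y j) hne
    (fun j => z j) (fun j => w j)
  simp only [hankelDet₂_updateRow_fst, hankelDet₂_updateRow_snd] at h
  simp only [← hankelDet₂.eq_1] at h
  rw [hankelDet₂_swap N m y z, hankelDet₂_swap N m y w] at h
  linear_combination h

theorem hankelDet₁_eval (N : ℕ) (m : ℕ → ℂ) (α : ℂ) :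
    hankelDet₁ N m (fun j => (-α) ^ j) = (-1) ^ N * hankelDet N (christoffel α m) := by
  have hcol : hankelDet₁ N m (fun j => (-α) ^ j) = (Matrix.of fun i j : Fin (N + 1) =>
      if (i : ℕ) < N then (Fin.cases (m i) (fun k => m (i + k + 1) + α * m (i + k)) j : ℂ)
      else (Fin.cases 1 (fun _ => 0) j : ℂ)).det := by
    unfold hankelDet₁
    refine Matrix.det_eq_of_forall_col_eq_smul_add_pred (fun _ => -α) (fun i => ?_) fun i j => ?_
    · simp
    · by_cases h : (i : ℕ) < N
      · simp [h, add_assoc]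
      · simp [h, pow_succ']
  rw [hcol, Matrix.det_succ_row _ (Fin.last N), Finset.sum_eq_single 0]
  · simp only [Matrix.of_apply, Fin.val_last, Fin.val_zero, lt_irrefl, if_false, add_zero,
      Fin.cases_zero, mul_one]
    congr 1
    unfold hankelDet
    congr 1
    ext i j
    simp [christoffel]
  · intro j _ hj
    obtain ⟨k, rfl⟩ := Fin.exists_succ_eq.2 hj
    simp
  · simp

theorem hankelDet₂_eval (N : ℕ) (m x : ℕ → ℂ) (α : ℂ) :
    hankelDet₂ N m x (fun j => (-α) ^ j) =
      (-1) ^ (N + 1) * hankelDet₁ N (christoffel α m) (christoffel α x) := by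
  have hcol : hankelDet₂ N m x (fun j => (-α) ^ j) = (Matrix.of fun i j : Fin (N + 2) =>
      if (i : ℕ) < N then (Fin.cases (m i) (fun k => m (i + k + 1) + α * m (i + k)) j : ℂ)
      else if (i : ℕ) = N then (Fin.cases (x 0) (fun k => x (k + 1) + α * x k) j : ℂ)
      else (Fin.cases 1 (fun _ => 0) j : ℂ)).det := by
    unfold hankelDet₂
    refine Matrix.det_eq_of_forall_col_eq_smul_add_pred (fun _ => -α) (fun i => ?_) fun i j => ?_
    · simp
    · by_cases h : (i : ℕ) < N
      · simp [h, add_assoc]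
      · by_cases h' : (i : ℕ) = N
        · simp [h']
        · simp [h, h', pow_succ']
  rw [hcol, Matrix.det_succ_row _ (Fin.last (N + 1)), Finset.sum_eq_single 0]
  · simp only [Matrix.of_apply, Fin.val_last, Fin.val_zero, add_zero, Fin.cases_zero,
      Nat.not_lt.2 (Nat.le_succ N), Nat.succ_ne_self, if_false, mul_one]
    congr 1
    unfold hankelDet₁
    congr 1
    ext i j
    have := i.isLt
    by_cases h : (i : ℕ) < N
    · simp [christoffel, h]
    · simp [christoffel, show (i : ℕ) = N by omega]
  · intro j _ hj
    obtain ⟨k, rfl⟩ := Fin.exists_succ_eq.2 hj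
    simp
  · simp

theorem hankelDet₁_single (N : ℕ) (m : ℕ → ℂ) :
    hankelDet₁ N m (Pi.single N 1) = hankelDet N m := by
  unfold hankelDet₁
  rw [Matrix.det_succ_row _ (Fin.last N), Finset.sum_eq_single (Fin.last N)]
  · simp only [Matrix.of_apply, Fin.val_last, lt_irrefl, if_false, Pi.single_eq_same, mul_one,
      Even.neg_pow (Even.add_self N), one_pow, one_mul]
    unfold hankelDet
    congr 1
    ext i j
    simp
  · intro j _ hj
    have : (j : ℕ) ≠ N := fun h => hj (Fin.ext h)
    simp [Pi.single_apply, this]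
  · simp

theorem hankelDet₂_single (N : ℕ) (m x : ℕ → ℂ) :
    hankelDet₂ N m x (Pi.single (N + 1) 1) = hankelDet₁ N m x := by
  unfold hankelDet₂
  rw [Matrix.det_succ_row _ (Fin.last (N + 1)), Finset.sum_eq_single (Fin.last (N + 1))]
  · simp only [Matrix.of_apply, Fin.val_last, Nat.not_lt.2 (Nat.le_succ N), Nat.succ_ne_self,
      if_false, Pi.single_eq_same, mul_one, Even.neg_pow (Even.add_self _), one_pow, one_mul]
    unfold hankelDet₁
    congr 1
    ext i j
    have := i.isLt
    by_cases h : (i : ℕ) < N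
    · simp [h]
    · simp [show (i : ℕ) = N by omega]
  · intro j _ hj
    have : (j : ℕ) ≠ N + 1 := fun h => hj (Fin.ext h)
    simp [Pi.single_apply, this]
  · simp

/-- A Hankel determinant with its last column shifted equals the one with its last row shifted. -/
theorem hankelDet₁_single_pred (N : ℕ) (m : ℕ → ℂ) :
    hankelDet₁ (N + 1) m (Pi.single N 1) = -hankelDetShift (N + 1) m := by
  unfold hankelDet₁ hankelDetShift
  rw [Matrix.det_succ_row _ (Fin.last (N + 1)), Finset.sum_eq_single (Fin.last N).castSucc]
  · simp only [Matrix.of_apply, Fin.val_last, lt_irrefl, if_false, Fin.val_castSucc,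
      Pi.single_eq_same, mul_one]
    rw [show (-1 : ℂ) ^ (N + 1 + N) = -1 from Odd.neg_one_pow ⟨N, by ring⟩, neg_one_mul, neg_inj]
    unfold hankelDet₁
    rw [← Matrix.det_transpose]
    congr 1
    ext i j
    have := i.isLt
    by_cases h : (i : ℕ) < N
    · simp [h, Fin.succAbove, Fin.lt_def, add_comm, Nat.not_lt.2 (Nat.le_of_lt_succ j.isLt)]
    · simp [show (i : ℕ) = N by omega, Fin.succAbove, Fin.lt_def, add_comm, add_left_comm,
        Nat.not_lt.2 (Nat.le_of_lt_succ j.isLt)]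
  · intro j _ hj
    have : (j : ℕ) ≠ N := fun h => hj (Fin.ext h)
    simp [Pi.single_apply, this]
  · simp

/-- Contiguity of Hankel determinants of equal size under a Christoffel transform. -/
theorem hankelDetShift_christoffel (n : ℕ) (m : ℕ → ℂ) (α : ℂ) :
    hankelDetShift n (christoffel α m) * hankelDet n m -
      hankelDet n (christoffel α m) * hankelDetShift n m =
    hankelDet (n + 1) m * hankelDetPred n (christoffel α m) := by
  cases n with
  | zero => simp [hankelDetShift, hankelDetPred]
  | succ N =>
    have h := hankelDet₂_plucker N m (fun j => m (N + j)) (fun j => m (N + 1 + j))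
      (fun j => (-α) ^ j) (Pi.single (N + 1) 1)
    simp only [hankelDet₂_eval, hankelDet₂_single, christoffel_shift, hankelDet₂_self, hankelDet₁_self,
      hankelDet₁_eval] at h
    simp only [hankelDetShift, hankelDetPred]
    have hs : ((-1 : ℂ) ^ N) ≠ 0 := by simp
    refine mul_left_cancel₀ hs ?_
    linear_combination -h

/-- Contiguity of Hankel determinants of consecutive sizes under a Christoffel transform. -/
theorem hankelDetShift_christoffel_succ (n : ℕ) (m : ℕ → ℂ) (α : ℂ) :
    hankelDetShift n (christoffel α m) * hankelDet (n + 1) m -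
      hankelDet n (christoffel α m) * hankelDetShift (n + 1) m =
    α * hankelDet n (christoffel α m) * hankelDet (n + 1) m -
      hankelDet (n + 1) (christoffel α m) * hankelDet n m := by
  have h := hankelDet₂_plucker n m (fun j => m (n + j)) (fun j => (-α) ^ j)
    (Pi.single n 1) (Pi.single (n + 1) 1)
  rw [hankelDet₂_swap n m (Pi.single n 1) (fun j => (-α) ^ j)] at h
  have e : hankelDet₁ n (christoffel α m) (christoffel α (Pi.single n 1)) =
      α * hankelDet n (christoffel α m) - hankelDetShift n (christoffel α m) := by
    cases n with
    | zero =>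
      simp [hankelDetShift, hankelDet, hankelDet₁, christoffel]
    | succ N =>
      rw [hankelDet₁_congr (y := fun j => (Pi.single N 1 : ℕ → ℂ) j +
        α * (Pi.single (N + 1) 1 : ℕ → ℂ) j), hankelDet₁_add_smul, hankelDet₁_single,
        hankelDet₁_single_pred]
      · ring
      · intro j _
        simp [christoffel, Pi.single_apply]
  simp only [hankelDet₂_eval, hankelDet₂_single, christoffel_shift, hankelDet₂_self, hankelDet₁_self,
    hankelDet₁_eval, hankelDet₁_single, hankelDet₁_single_pred, e] at h
  have hs : ((-1 : ℂ) ^ n) ≠ 0 := by simp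
  refine mul_left_cancel₀ hs ?_
  linear_combination -h

/-- The Hirota–Miwa relation between two Christoffel transforms. -/
theorem hankelDet_christoffel_christoffel (N : ℕ) (m : ℕ → ℂ) (α β : ℂ) :
    (β - α) * hankelDet (N + 1) m * hankelDet N (christoffel α (christoffel β m)) =
      hankelDet (N + 1) (christoffel β m) * hankelDet N (christoffel α m) -
        hankelDet (N + 1) (christoffel α m) * hankelDet N (christoffel β m) := by
  have h := hankelDet₂_plucker N m (fun j => m (N + j)) (fun j => (-α) ^ j)
    (fun j => (-β) ^ j) (Pi.single (N + 1) 1)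
  have e : hankelDet₁ N (christoffel β m) (christoffel β fun j => (-α) ^ j) =
      (β - α) * ((-1) ^ N * hankelDet N (christoffel α (christoffel β m))) := by
    rw [← hankelDet₁_eval, hankelDet₁_congr (y := fun j => 0 + (β - α) * (-α) ^ j)]
    · rw [hankelDet₁_add_smul N _ (fun _ => 0)]
      have := hankelDet₁_add_smul N (christoffel β m) (fun _ => 0) (fun _ => 0) 1
      simp only [mul_zero, add_zero, one_mul, left_eq_add] at this
      rw [this, zero_add]
    · intro j _
      simp only [christoffel]
      ring
  simp only [hankelDet₂_eval, hankelDet₂_single, christoffel_shift, hankelDet₁_self,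
    hankelDet₁_eval, e] at h
  have hs : ((-1 : ℂ) ^ N) * (-1) ^ N ≠ 0 := by simp
  refine mul_left_cancel₀ hs ?_
  linear_combination -h

theorem Matrix.hasDerivAt_det {ι : Type*} [Fintype ι] [DecidableEq ι] {M : ℝ → Matrix ι ι ℂ}
    {M' : Matrix ι ι ℂ} {t : ℝ} (h : ∀ i j, HasDerivAt (fun s => M s i j) (M' i j) t) :
    HasDerivAt (fun s => (M s).det) (∑ k, ((M t).updateCol k fun i => M' i k).det) t := by
  have h1 : HasDerivAt (fun s => (M s).det) (∑ σ : Equiv.Perm ι, (Equiv.Perm.sign σ : ℂ) *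
      ∑ k, (∏ j ∈ Finset.univ.erase k, M t (σ j) j) • M' (σ k) k) t := by
    simp only [Matrix.det_apply']
    exact HasDerivAt.fun_sum fun σ _ =>
      (HasDerivAt.fun_finsetProd fun k _ => h (σ k) k).const_mul _
  convert! h1 using 1
  simp only [Matrix.det_apply', Finset.mul_sum]
  rw [Finset.sum_comm]
  refine Finset.sum_congr rfl fun σ _ => Finset.sum_congr rfl fun k _ => ?_
  rw [← Finset.mul_prod_erase _ _ (Finset.mem_univ k)]
  simp only [Matrix.updateCol_self, smul_eq_mul]
  rw [mul_comm (M' (σ k) k)]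
  congr 2
  refine Finset.prod_congr rfl fun j hj => ?_
  rw [Matrix.updateCol_ne (Finset.ne_of_mem_erase hj)]

theorem hasDerivAt_hankelDet {m : ℝ → ℕ → ℂ} {t : ℝ} {z : ℂ}
    (h : ∀ k, HasDerivAt (fun s => m s k) (z * m t (k + 1)) t) (N : ℕ) :
    HasDerivAt (fun s => hankelDet N (m s)) (z * hankelDetShift N (m t)) t := by
  have hd := Matrix.hasDerivAt_det (M := fun s => Matrix.of fun i j : Fin N => m s (i + j))
    (M' := Matrix.of fun i j : Fin N => z * m t (i + j + 1)) (t := t) fun i j => h (i + j)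
  cases N with
  | zero => simpa [hankelDetShift, hankelDet] using hd
  | succ N =>
    unfold hankelDet
    convert! hd using 1
    rw [Finset.sum_eq_single (Fin.last N)]
    · have e : (fun i : Fin (N + 1) => z * m t (i + (Fin.last N : ℕ) + 1)) =
          z • fun i : Fin (N + 1) => m t (N + 1 + i) := by
        funext i
        simp only [Fin.val_last, Pi.smul_apply, smul_eq_mul]
        congr 2
        ring
      simp only [Matrix.of_apply]
      rw [e, Matrix.det_updateCol_smul, hankelDetShift, hankelDet₁, ← Matrix.det_transpose]
      congr 2
      ext i j
      have := j.isLt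
      by_cases h : (j : ℕ) < N
      · rw [Matrix.updateCol_ne (by simp [Fin.ext_iff, h.ne])]
        simp [h, add_comm]
      · rw [show j = Fin.last N by simp [Fin.ext_iff]; omega]
        simp
    · intro k _ hk
      have hk' : (k : ℕ) < N := lt_of_le_of_ne (Nat.le_of_lt_succ k.isLt) fun h => hk (Fin.ext h)
      have e : (fun i : Fin (N + 1) => z * m t (i + (k : ℕ) + 1)) =
          z • fun i : Fin (N + 1) => m t (i + (k : ℕ) + 1) := rfl
      have hne : k ≠ (⟨k + 1, by omega⟩ : Fin (N + 1)) := by simp [Fin.ext_iff]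
      simp only [Matrix.of_apply]
      rw [e, Matrix.det_updateCol_smul, Matrix.det_zero_of_column_eq hne]
      · exact mul_zero _
      · intro i
        rw [Matrix.updateCol_self, Matrix.updateCol_ne hne.symm]
        rfl
    · simp

/-- Hankel determinants are invariant under the binomial transform. -/
theorem hankelDet_binomial (N : ℕ) (m : ℕ → ℂ) :
    hankelDet N (fun k => ∑ r ∈ Finset.range (k + 1), (k.choose r : ℂ) * m r) = hankelDet N m := by
  let Λ : Polynomial ℂ →ₗ[ℂ] ℂ := Polynomial.lsum fun k => LinearMap.toSpanSingleton ℂ ℂ (m k)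
  have hΛ (k : ℕ) : Λ (Polynomial.X ^ k) = m k := by
    simp [Λ, Polynomial.lsum_apply, ← Polynomial.monomial_one_right_eq_X_pow,
      Polynomial.sum_monomial_index]
  have hadd (k : ℕ) : (Polynomial.X + 1 : Polynomial ℂ) ^ k =
      ∑ r ∈ Finset.range (k + 1), (k.choose r : ℂ) • Polynomial.X ^ r := by
    rw [add_pow]
    refine Finset.sum_congr rfl fun r _ => ?_
    rw [one_pow, mul_one, mul_comm, Algebra.smul_def, map_natCast]
  let P : Matrix (Fin N) (Fin N) ℂ := Matrix.of fun i j => ((i : ℕ).choose j : ℂ)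
  have hP : P.det = 1 := by
    rw [Matrix.det_of_isLowerTriangular]
    · simp [P]
    · intro i j hij
      simp [P, Nat.choose_eq_zero_of_lt (show (i : ℕ) < j from OrderDual.toDual_lt_toDual.1 hij)]
  have hrange (k : ℕ) (hk : k < N) (f : ℕ → ℂ) :
      ∑ r ∈ Finset.range (k + 1), (k.choose r : ℂ) * f r = ∑ r : Fin N, (k.choose r : ℂ) * f r := by
    rw [Fin.sum_univ_eq_sum_range fun r => (k.choose r : ℂ) * f r]
    refine Finset.sum_subset (by simpa using hk) fun r _ hr => ?_
    rw [Nat.choose_eq_zero_of_lt (by simpa using hr)]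
    simp
  have hprod : (Matrix.of fun i j : Fin N =>
      ∑ r ∈ Finset.range ((i + j : ℕ) + 1), ((i + j : ℕ).choose r : ℂ) * m r) =
      P * (Matrix.of fun i j : Fin N => m (i + j)) * P.transpose := by
    ext i j
    have h1 : Λ ((Polynomial.X + 1) ^ (i + j : ℕ)) =
        ∑ r ∈ Finset.range ((i + j : ℕ) + 1), ((i + j : ℕ).choose r : ℂ) * m r := by
      rw [hadd, map_sum]
      simp [hΛ]
    rw [Matrix.of_apply, ← h1, pow_add, hadd, hadd, Finset.sum_mul_sum, map_sum]
    simp only [map_sum, smul_mul_smul_comm, ← pow_add, map_smul, hΛ, smul_eq_mul, mul_assoc,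
      ← Finset.mul_sum]
    rw [hrange i i.isLt fun r => ∑ s ∈ Finset.range ((j : ℕ) + 1), ((j : ℕ).choose s : ℂ) * m (r + s)]
    simp only [hrange j j.isLt]
    simp only [Matrix.mul_apply, Matrix.transpose_apply, P, Matrix.of_apply]
    exact Finset.sum_congr rfl fun r _ => congrArg _ <|
      Finset.sum_congr rfl fun s _ => mul_comm _ _
  unfold hankelDet
  rw [hprod, Matrix.det_mul, Matrix.det_mul, Matrix.det_transpose, hP]
  simp

theorem hankelDet_const_mul (N : ℕ) (m : ℕ → ℂ) (κ : ℂ) :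
    hankelDet N (fun k => κ * m k) = κ ^ N * hankelDet N m := by
  have := Matrix.det_smul (Matrix.of fun i j : Fin N => m (i + j)) κ
  rw [Fintype.card_fin] at this
  exact this

theorem HasDerivAt.christoffel {m : ℝ → ℕ → ℂ} {t : ℝ} {z : ℂ}
    (h : ∀ k, HasDerivAt (fun s => m s k) (z * m t (k + 1)) t) (α : ℂ) (k : ℕ) :
    HasDerivAt (fun s => _root_.christoffel α (m s) k)
      (z * _root_.christoffel α (m t) (k + 1)) t := by
  convert! (h (k + 1)).add ((h k).const_mul α) using 1
  simp only [_root_.christoffel]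
  ring

theorem hasDerivAt_hankelDetPred {m : ℝ → ℕ → ℂ} {t : ℝ} {z : ℂ}
    (h : ∀ k, HasDerivAt (fun s => m s k) (z * m t (k + 1)) t) (N : ℕ) :
    HasDerivAt (fun s => hankelDetPred N (m s)) (z * hankelDetShiftPred N (m t)) t := by
  cases N with
  | zero => simpa [hankelDetPred, hankelDetShiftPred] using hasDerivAt_const t (0 : ℂ)
  | succ N => exact hasDerivAt_hankelDet h N

theorem hankelDetShiftPred_christoffel (n : ℕ) (m : ℕ → ℂ) (α : ℂ) :
    hankelDetShiftPred n (christoffel α m) * hankelDet n m -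
      hankelDetPred n (christoffel α m) * hankelDetShift n m =
    α * hankelDetPred n (christoffel α m) * hankelDet n m -
      hankelDet n (christoffel α m) * hankelDetPred n m := by
  cases n with
  | zero => simp [hankelDetShiftPred, hankelDetPred]
  | succ N => exact hankelDetShift_christoffel_succ N m α

/-- The logarithmic form of the contiguity relations implies the Hamiltonian equations. Here `x`,
`b`, `e` are the cross ratios of Hankel determinants and `s₀`, `s₁`, `r`, `v` are the logarithmic
derivatives. -/
theorem pV_of_logDeriv {a c t x b e s₀ s₁ r v y ν dx de db g : ℂ}
    (h₁ : s₀ + ν - r = x * b) (h₃ : v - s₀ = e) (h₄ : v - r = x * e) (h₅ : v - s₁ = c - y)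
    (h₆ : x * (v - s₀ - ν) - t = a * x - y)
    (hx : dx = x * (s₀ - r - s₁) + (s₀ + ν) * x + t)
    (he : de = e * (s₁ - s₀ - v) + e * (s₀ + c) - t * b)
    (hg : g = t * b - e * (c - a + s₀ - r))
    (hb : db = b * (s₁ - 2 * s₀ + r - ν) - g) :
    -dx = 2 * (1 - x) * ((1 - x) - 1) ^ 2 * (e - b) -
        ((c - a) * ((1 - x) - 1) ^ 2 + (-c + ν) * (1 - x) * ((1 - x) - 1) + t * (1 - x)) ∧
    de - db = -((((1 - x) - 1) ^ 2 + 2 * (1 - x) * ((1 - x) - 1)) * (e - b) ^ 2 -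
        (2 * (c - a) * ((1 - x) - 1) + (-c + ν) * (2 * (1 - x) - 1) + t) * (e - b) +
        ((1 / 4) * ((c - a) + (-c + ν)) ^ 2 - (1 / 4) * (a + ν) ^ 2)) := by
  obtain rfl : v = s₀ + e := by linear_combination h₃
  obtain rfl : r = s₀ + e - x * e := by linear_combination -h₄
  obtain rfl : s₁ = s₀ + e - c + y := by linear_combination -h₅
  obtain rfl : y = a * x + t - x * (e - ν) := by linear_combination h₆
  obtain rfl : ν = x * b + (e - x * e) := by linear_combination h₁
  subst hx he hg hb
  constructor <;> ring

/-- Hankel determinants of a moment sequence evolving by the Toda flow, with a first-order discrete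
Pearson equation relating its Christoffel transforms, solve the Hamiltonian system. -/
theorem hasDerivAt_pV_of_hankelDet {a c : ℂ} {n : ℕ} {m : ℝ → ℕ → ℂ} {t : ℝ} (ht : 0 < t)
    (hm : ∀ k, HasDerivAt (fun s => m s k) ((t : ℂ)⁻¹ * m t (k + 1)) t)
    (hP : ∀ N : ℕ, ∀ s : ℝ, 0 < s → hankelDet N (christoffel 0 (christoffel c (m s))) =
      (s : ℂ) ^ N * hankelDet N (christoffel a (m s)))
    (hA : hankelDet n (christoffel a (m t)) ≠ 0)
    (hA₁ : hankelDet (n + 1) (christoffel a (m t)) ≠ 0)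
    (hC : hankelDet n (christoffel c (m t)) ≠ 0)
    (hAC : hankelDet n (christoffel a (christoffel c (m t))) ≠ 0)
    {q p : ℝ → ℂ}
    (hq : ∀ s, q s = 1 - hankelDet n (christoffel a (m s)) * hankelDet (n + 1) (christoffel c (m s)) /
      (hankelDet n (christoffel c (m s)) * hankelDet (n + 1) (christoffel a (m s))))
    (hp : ∀ s, p s = hankelDet (n + 1) (christoffel a (m s)) *
        hankelDetPred n (christoffel a (christoffel c (m s))) /
        (hankelDet n (christoffel a (m s)) * hankelDet n (christoffel a (christoffel c (m s)))) -
      hankelDet (n + 1) (christoffel a (m s)) * hankelDetPred n (christoffel a (m s)) /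
        ((s : ℂ) * hankelDet n (christoffel a (m s)) ^ 2)) :
    (t : ℂ) * deriv q t =
        2 * q t * (q t - 1) ^ 2 * p t
          - ((c - a) * (q t - 1) ^ 2 + (-c + n) * q t * (q t - 1) + (t : ℂ) * q t) ∧
      (t : ℂ) * deriv p t =
        -(((q t - 1) ^ 2 + 2 * q t * (q t - 1)) * (p t) ^ 2
            - (2 * (c - a) * (q t - 1) + (-c + n) * (2 * q t - 1) + (t : ℂ)) * p t
            + ((1 / 4) * ((c - a) + (-c + n)) ^ 2 - (1 / 4) * (a + n) ^ 2)) := by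
  have htC : (t : ℂ) ≠ 0 := by exact_mod_cast ht.ne'
  have hma := HasDerivAt.christoffel hm a
  have hmc := HasDerivAt.christoffel hm c
  have hmac := HasDerivAt.christoffel hmc a
  have hm0c := HasDerivAt.christoffel hmc 0
  have dA := hasDerivAt_hankelDet hma n
  have dA₁ := hasDerivAt_hankelDet hma (n + 1)
  have dC := hasDerivAt_hankelDet hmc n
  have dC₁ := hasDerivAt_hankelDet hmc (n + 1)
  have dAC := hasDerivAt_hankelDet hmac n
  have dAm := hasDerivAt_hankelDetPred hma n
  have dACm := hasDerivAt_hankelDetPred hmac n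
  have hP' (N : ℕ) : hankelDetShift N (christoffel 0 (christoffel c (m t))) =
      (t : ℂ) ^ N * (hankelDetShift N (christoffel a (m t)) +
        N * hankelDet N (christoffel a (m t))) := by
    have h1 := hasDerivAt_hankelDet hm0c N
    have h2 := ((hasDerivAt_id t).ofReal_comp.pow N).mul (hasDerivAt_hankelDet hma N)
    have h3 := h1.congr_of_eventuallyEq (f₁ := fun s : ℝ => (s : ℂ) ^ N *
      hankelDet N (christoffel a (m s))) (by
        filter_upwards [lt_mem_nhds ht] with s hs using (hP N s hs).symm)
    have h4 := h3.unique h2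
    simp only [Pi.pow_apply, id, Complex.ofReal_one, mul_one] at h4
    have h5 : (t : ℂ) * (N * (t : ℂ) ^ (N - 1)) = N * (t : ℂ) ^ N := by
      cases N with
      | zero => simp
      | succ N => rw [Nat.add_sub_cancel]; ring
    refine mul_left_cancel₀ (inv_ne_zero htC) ?_
    rw [h4]
    have h6 : (N : ℂ) * (t : ℂ) ^ (N - 1) = (t : ℂ)⁻¹ * (N * (t : ℂ) ^ N) := by
      rw [← h5, inv_mul_cancel_left₀ htC]
    rw [h6]
    ring
  have r₁ : (t : ℂ) * ((hankelDetShift n (christoffel a (m t)) +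
        n * hankelDet n (christoffel a (m t))) * hankelDet n (christoffel c (m t)) -
      hankelDet n (christoffel a (m t)) * hankelDetShift n (christoffel c (m t))) =
      hankelDet (n + 1) (christoffel c (m t)) * hankelDetPred n (christoffel a (m t)) := by
    have h := hankelDetShift_christoffel n (christoffel c (m t)) 0
    rw [hP', hP n t ht] at h
    have hpred : (t : ℂ) * hankelDetPred n (christoffel 0 (christoffel c (m t))) =
        (t : ℂ) ^ n * hankelDetPred n (christoffel a (m t)) := by
      cases n with
      | zero => simp [hankelDetPred]
      | succ N => simp only [hankelDetPred, hP N t ht]; ring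
    refine mul_left_cancel₀ (pow_ne_zero n htC) ?_
    linear_combination (t : ℂ) * h + hankelDet (n + 1) (christoffel c (m t)) * hpred
  have r₂ : (hankelDetShift n (christoffel a (m t)) +
        n * hankelDet n (christoffel a (m t))) * hankelDet (n + 1) (christoffel c (m t)) -
      hankelDet n (christoffel a (m t)) * hankelDetShift (n + 1) (christoffel c (m t)) =
      -((t : ℂ) * hankelDet (n + 1) (christoffel a (m t)) * hankelDet n (christoffel c (m t))) := by
    have h := hankelDetShift_christoffel_succ n (christoffel c (m t)) 0
    rw [hP', hP n t ht, hP (n + 1) t ht] at h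
    refine mul_left_cancel₀ (pow_ne_zero n htC) ?_
    linear_combination h
  have r₃ := hankelDetShift_christoffel n (christoffel a (m t)) c
  have r₄ := hankelDetShift_christoffel n (christoffel c (m t)) a
  have r₅ := hankelDetShift_christoffel_succ n (christoffel a (m t)) c
  have r₆ := hankelDetShift_christoffel_succ n (christoffel c (m t)) a
  have r₇ := hankelDetShiftPred_christoffel n (christoffel a (m t)) c
  have r₈ := hankelDetShiftPred_christoffel n (christoffel c (m t)) a
  have r₉ : (hankelDetShiftPred n (christoffel a (m t)) +
        (n - 1) * hankelDetPred n (christoffel a (m t))) * hankelDet n (christoffel c (m t)) -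
      hankelDetPred n (christoffel a (m t)) * hankelDetShift n (christoffel c (m t)) =
      -((t : ℂ) * hankelDet n (christoffel a (m t)) * hankelDetPred n (christoffel c (m t))) := by
    cases n with
    | zero => simp [hankelDetPred, hankelDetShiftPred]
    | succ N =>
      have h := hankelDetShift_christoffel_succ N (christoffel c (m t)) 0
      rw [hP', hP N t ht, hP (N + 1) t ht] at h
      refine mul_left_cancel₀ (pow_ne_zero N htC) ?_
      simp only [hankelDetPred, hankelDetShiftPred]
      push_cast
      linear_combination h
  rw [christoffel_comm c a] at r₃ r₅ r₇
  have hdq := ((dA.mul dC₁).div (dC.mul dA₁) (mul_ne_zero hC hA₁)).const_sub 1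
  have hdp := ((dA₁.mul dACm).div (dA.mul dAC) (mul_ne_zero hA hAC)).sub
    ((dA₁.mul dAm).div ((hasDerivAt_id t).ofReal_comp.mul (dA.pow 2))
      (mul_ne_zero htC (pow_ne_zero 2 hA)))
  have hdq' : deriv q t = _ := (hdq.congr_of_eventuallyEq (.of_forall hq)).deriv
  have hdp' : deriv p t = _ := (hdp.congr_of_eventuallyEq (.of_forall hp)).deriv
  rw [hdq', hdp', hq t, hp t]
  clear hdq hdp hdq' hdp' hq hp dA dA₁ dC dC₁ dAC dAm dACm hma hmc hmac hm0c hP hP' hm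
  simp only [Pi.mul_apply, Pi.pow_apply, id, Complex.ofReal_one]
  generalize hankelDet n (christoffel a (m t)) = A at *
  generalize hankelDet (n + 1) (christoffel a (m t)) = A₁ at *
  generalize hankelDet n (christoffel c (m t)) = C at *
  generalize hankelDet (n + 1) (christoffel c (m t)) = C₁ at *
  generalize hankelDet n (christoffel a (christoffel c (m t))) = D at *
  generalize hankelDet (n + 1) (christoffel a (christoffel c (m t))) = D₁ at *
  generalize hankelDetPred n (christoffel a (m t)) = A₀ at *
  generalize hankelDetPred n (christoffel c (m t)) = C₀ at *
  generalize hankelDetPred n (christoffel a (christoffel c (m t))) = D₀ at *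
  generalize hankelDetShift n (christoffel a (m t)) = A' at *
  generalize hankelDetShift (n + 1) (christoffel a (m t)) = A₁' at *
  generalize hankelDetShift n (christoffel c (m t)) = C' at *
  generalize hankelDetShift (n + 1) (christoffel c (m t)) = C₁' at *
  generalize hankelDetShift n (christoffel a (christoffel c (m t))) = D' at *
  generalize hankelDetShiftPred n (christoffel a (m t)) = A₀' at *
  generalize hankelDetShiftPred n (christoffel a (christoffel c (m t))) = D₀' at *
  generalize (t : ℂ) = T at *
  generalize (n : ℂ) = ν at *
  have key := pV_of_logDeriv (a := a) (c := c) (t := T) (x := A * C₁ / (C * A₁))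
    (b := A₁ * A₀ / (T * A ^ 2)) (e := A₁ * D₀ / (A * D)) (s₀ := A' / A) (s₁ := A₁' / A₁)
    (r := C' / C) (v := D' / D) (y := D₁ * A / (D * A₁)) (ν := ν)
    (dx := A * C₁ / (C * A₁) * (A' / A - C' / C - A₁' / A₁) + A * C₁' / (C * A₁))
    (de := A₁ * D₀ / (A * D) * (A₁' / A₁ - A' / A - D' / D) + A₁ * D₀' / (A * D))
    (db := A₁ * A₀ / (T * A ^ 2) * (A₁' / A₁ - 2 * (A' / A) - 1) + A₁ * A₀' / (T * A ^ 2))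
    (g := A₁ * C₀ / (A * C))
    (by field_simp; linear_combination r₁)
    (by field_simp; linear_combination r₃)
    (by field_simp; linear_combination r₄)
    (by field_simp; linear_combination r₅)
    (by field_simp; linear_combination A * r₆ - D * r₂)
    (by field_simp; linear_combination (-(A₁ * C)) * r₂)
    (by field_simp; linear_combination D * A₁ * r₇)
    (by field_simp; linear_combination A * r₈ - C * r₇)
    (by field_simp; linear_combination A * A₁ * r₉)
  refine ⟨Eq.trans ?_ key.1, Eq.trans ?_ key.2⟩
  · field_simp
    ring
  · field_simp
    ring

theorem ascPochhammer_eval_add_one (a : ℂ) (n : ℕ) :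
    a * (ascPochhammer ℂ n).eval (a + 1) = (ascPochhammer ℂ n).eval a * (a + n) := by
  rw [← ascPochhammer_succ_eval, ascPochhammer_succ_left]
  simp

theorem ascPochhammer_eval_ne_zero_of_notMem {a : ℂ} (ha : a ∉ Set.range ((↑·) : ℤ → ℂ)) (n : ℕ) :
    (ascPochhammer ℂ n).eval a ≠ 0 := by
  induction n with
  | zero => simp
  | succ n ih =>
    rw [ascPochhammer_succ_eval]
    refine mul_ne_zero ih fun h => ha ⟨-n, ?_⟩
    push_cast
    linear_combination -h

/-- The coefficients of Kummer's series. -/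
noncomputable def kummerCoeff (a c : ℂ) (n : ℕ) : ℂ :=
  Polynomial.eval a (ascPochhammer ℂ n) / (Polynomial.eval c (ascPochhammer ℂ n) * (n.factorial : ℂ))

theorem ne_zero_of_notMem_range {a : ℂ} (ha : a ∉ Set.range ((↑·) : ℤ → ℂ)) : a ≠ 0 :=
  fun h => ha ⟨0, by simp [h]⟩

theorem add_intCast_notMem_range {a : ℂ} (ha : a ∉ Set.range ((↑·) : ℤ → ℂ)) (i : ℤ) :
    a + i ∉ Set.range ((↑·) : ℤ → ℂ) := by
  rintro ⟨k, hk⟩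
  refine ha ⟨k - i, ?_⟩
  have hk' : (k : ℂ) = a + i := hk
  push_cast
  rw [hk']
  ring

theorem neg_notMem_range {a : ℂ} (ha : a ∉ Set.range ((↑·) : ℤ → ℂ)) :
    -a ∉ Set.range ((↑·) : ℤ → ℂ) := by
  rintro ⟨k, hk⟩
  refine ha ⟨-k, ?_⟩
  have hk' : (k : ℂ) = -a := hk
  push_cast
  rw [hk', neg_neg]

theorem kummerCoeff_succ (a c : ℂ) (n : ℕ) :
    kummerCoeff a c (n + 1) = kummerCoeff a c n * ((a + n) / ((c + n) * (n + 1))) := by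
  simp only [kummerCoeff, ascPochhammer_succ_eval, Nat.factorial_succ]
  push_cast
  rw [div_mul_div_comm]
  congr 1
  ring

theorem kummerCoeff_succ_mul {a c : ℂ} (hc : c ∉ Set.range ((↑·) : ℤ → ℂ)) (n : ℕ) :
    kummerCoeff a c (n + 1) * (n + 1) = a / c * kummerCoeff (a + 1) (c + 1) n := by
  have h1 := ascPochhammer_eval_add_one a n
  have h2 := ascPochhammer_eval_add_one c n
  have hc0 := ne_zero_of_notMem_range hc
  have hcn := ascPochhammer_eval_ne_zero_of_notMem hc (n + 1)
  have hn : (n + 1 : ℂ) ≠ 0 := by exact_mod_cast n.succ_ne_zero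
  have hf : (n.factorial : ℂ) ≠ 0 := by exact_mod_cast n.factorial_ne_zero
  have hc1 : (ascPochhammer ℂ n).eval (c + 1) ≠ 0 := by
    simpa using ascPochhammer_eval_ne_zero_of_notMem (add_intCast_notMem_range hc 1) n
  simp only [kummerCoeff, Nat.factorial_succ, Nat.cast_mul, Nat.cast_succ]
  rw [ascPochhammer_succ_eval] at hcn
  rw [ascPochhammer_succ_eval, ascPochhammer_succ_eval, ← h1, ← h2]
  field_simp

theorem mul_kummerCoeff_add_one (a c : ℂ) (n : ℕ) :
    a * kummerCoeff (a + 1) c n = n * kummerCoeff a c n + a * kummerCoeff a c n := by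
  rw [kummerCoeff, ← mul_div_assoc, ascPochhammer_eval_add_one, kummerCoeff]
  ring

theorem mul_kummerCoeff_sub_one {c : ℂ} (hc : c ∉ Set.range ((↑·) : ℤ → ℂ)) (a : ℂ) (n : ℕ) :
    (c - 1) * kummerCoeff a (c - 1) n = n * kummerCoeff a c n + (c - 1) * kummerCoeff a c n := by
  have h := ascPochhammer_eval_add_one (c - 1) n
  have hc1 : c - 1 ∉ Set.range ((↑·) : ℤ → ℂ) := by
    simpa [sub_eq_add_neg] using add_intCast_notMem_range hc (-1)
  have hf : (n.factorial : ℂ) ≠ 0 := by exact_mod_cast n.factorial_ne_zero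
  have h1 := ascPochhammer_eval_ne_zero_of_notMem hc n
  have h2 := ascPochhammer_eval_ne_zero_of_notMem hc1 n
  rw [sub_add_cancel] at h
  simp only [kummerCoeff]
  field_simp
  linear_combination Polynomial.eval a (ascPochhammer ℂ n) * h

theorem summable_norm_kummerCoeff {a c : ℂ} (ha : a ∉ Set.range ((↑·) : ℤ → ℂ))
    (hc : c ∉ Set.range ((↑·) : ℤ → ℂ)) {r : ℝ} (hr : 0 < r) :
    Summable fun n => ‖kummerCoeff a c n‖ * r ^ n := by
  have hpos (n : ℕ) : ‖kummerCoeff a c n‖ * r ^ n ≠ 0 := by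
    refine mul_ne_zero (norm_ne_zero_iff.2 (div_ne_zero
      (ascPochhammer_eval_ne_zero_of_notMem ha n) (mul_ne_zero
      (ascPochhammer_eval_ne_zero_of_notMem hc n) ?_))) (pow_ne_zero n hr.ne')
    exact_mod_cast n.factorial_ne_zero
  have hcn (n : ℕ) : c + n ≠ 0 := by
    simpa using ne_zero_of_notMem_range (add_intCast_notMem_range hc n)
  refine summable_of_ratio_test_tendsto_lt_one zero_lt_one (.of_forall hpos) ?_
  have hlim : Filter.Tendsto (fun n : ℕ => ‖(a + n) / (c + n) * (1 / ((n : ℂ) + 1))‖ * r)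
      Filter.atTop (nhds 0) := by
    have h1 : Filter.Tendsto (fun n : ℕ => (a + n) / (c + n)) Filter.atTop (nhds (1 : ℂ)) := by
      have h2 : Filter.Tendsto (fun n : ℕ => 1 + (a - c) * (c + n)⁻¹) Filter.atTop
          (nhds (1 + (a - c) * 0)) := by
        refine tendsto_const_nhds.add (tendsto_const_nhds.mul ?_)
        refine Filter.tendsto_inv₀_cobounded.comp ?_
        rw [← tendsto_norm_atTop_iff_cobounded]
        refine Filter.tendsto_atTop_mono (f := fun n : ℕ => -‖c‖ + n) (fun n => ?_)
          (Filter.tendsto_atTop_add_const_left _ _ tendsto_natCast_atTop_atTop)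
        have := norm_sub_le (c + n) c
        rw [add_sub_cancel_left, Complex.norm_natCast] at this
        linarith
      rw [mul_zero, add_zero] at h2
      refine h2.congr fun n => ?_
      have := hcn n
      field_simp
      ring
    have h3 := ((h1.mul (tendsto_one_div_add_atTop_nhds_zero_nat (𝕜 := ℂ))).norm).mul_const r
    simpa using h3
  refine hlim.congr fun n => ?_
  have h0 := hpos n
  have h4 : ‖kummerCoeff a c n‖ ≠ 0 := left_ne_zero_of_mul h0
  rw [Real.norm_of_nonneg (by positivity), Real.norm_of_nonneg (by positivity), eq_div_iff h0,
    kummerCoeff_succ, div_mul_div_comm, mul_one, norm_mul]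
  ring

theorem hasSum_kummerF {a c : ℂ} (ha : a ∉ Set.range ((↑·) : ℤ → ℂ))
    (hc : c ∉ Set.range ((↑·) : ℤ → ℂ)) (t : ℝ) :
    HasSum (fun n => kummerCoeff a c n * (t : ℂ) ^ n) (kummerF a c t) := by
  refine Summable.hasSum (.of_norm_bounded
    (summable_norm_kummerCoeff ha hc (r := |t| + 1) (by positivity)) fun n => ?_)
  rw [norm_mul, norm_pow, Complex.norm_real, Real.norm_eq_abs]
  gcongr
  linarith

theorem hasDerivAt_kummerF {a c : ℂ} (ha : a ∉ Set.range ((↑·) : ℤ → ℂ))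
    (hc : c ∉ Set.range ((↑·) : ℤ → ℂ)) (t : ℝ) :
    HasDerivAt (kummerF a c) (a / c * kummerF (a + 1) (c + 1) t) t := by
  have ha' : a + 1 ∉ Set.range ((↑·) : ℤ → ℂ) := by simpa using add_intCast_notMem_range ha 1
  have hc' : c + 1 ∉ Set.range ((↑·) : ℤ → ℂ) := by simpa using add_intCast_notMem_range hc 1
  have hR : 0 < |t| + 1 := by positivity
  have h := hasDerivAt_tsum_of_isPreconnected (𝕜 := ℝ)
    (u := fun n => ‖kummerCoeff a c n‖ * (2 * (|t| + 1)) ^ n)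
    (g := fun n (s : ℝ) => kummerCoeff a c n * (s : ℂ) ^ n)
    (g' := fun n (s : ℝ) => kummerCoeff a c n * (n * (s : ℂ) ^ (n - 1)))
    (summable_norm_kummerCoeff ha hc (by positivity)) (Metric.isOpen_ball (x := 0) (ε := |t| + 1))
    (convex_ball 0 _).isPreconnected (fun n s _ => ?_) (fun n s hs => ?_)
    (Metric.mem_ball_self hR) (hasSum_kummerF ha hc 0).summable (y := t) (by simp)
  · convert! h using 1
    have h1 := (hasSum_kummerF ha' hc' t).mul_left (a / c)
    refine ((hasSum_nat_add_iff' 1).1 ?_).tsum_eq.symm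
    convert! h1 using 1
    · funext n
      rw [Nat.add_sub_cancel]
      push_cast
      linear_combination (t : ℂ) ^ n * kummerCoeff_succ_mul (a := a) hc n
    · simp
  · simpa using ((hasDerivAt_id s).ofReal_comp.pow n).const_mul (kummerCoeff a c n)
  · rw [norm_mul, norm_mul, norm_pow, Complex.norm_real, Complex.norm_natCast, mul_pow]
    have hs' : ‖s‖ ≤ |t| + 1 := by simpa using (mem_ball_zero_iff.1 hs).le
    gcongr
    · exact_mod_cast Nat.lt_two_pow_self.le
    · calc ‖s‖ ^ (n - 1) ≤ (|t| + 1) ^ (n - 1) := by gcongr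
        _ ≤ (|t| + 1) ^ n := pow_le_pow_right₀ (by linarith [abs_nonneg t]) (Nat.sub_le n 1)

theorem hasSum_mul_kummerCoeff {a c : ℂ} (ha : a ∉ Set.range ((↑·) : ℤ → ℂ))
    (hc : c ∉ Set.range ((↑·) : ℤ → ℂ)) (t : ℝ) :
    HasSum (fun n : ℕ => n * kummerCoeff a c n * (t : ℂ) ^ n)
      (t * (a / c * kummerF (a + 1) (c + 1) t)) := by
  have ha' : a + 1 ∉ Set.range ((↑·) : ℤ → ℂ) := by simpa using add_intCast_notMem_range ha 1
  have hc' : c + 1 ∉ Set.range ((↑·) : ℤ → ℂ) := by simpa using add_intCast_notMem_range hc 1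
  rw [← hasSum_nat_add_iff' 1]
  convert! ((hasSum_kummerF ha' hc' t).mul_left (a / c)).mul_left (t : ℂ) using 1
  · funext n
    push_cast
    linear_combination (t : ℂ) ^ (n + 1) * kummerCoeff_succ_mul (a := a) hc n
  · simp

theorem kummerF_add_one_left {a c : ℂ} (ha : a ∉ Set.range ((↑·) : ℤ → ℂ))
    (hc : c ∉ Set.range ((↑·) : ℤ → ℂ)) (t : ℝ) :
    t * (a / c * kummerF (a + 1) (c + 1) t) + a * kummerF a c t = a * kummerF (a + 1) c t := by
  have ha' : a + 1 ∉ Set.range ((↑·) : ℤ → ℂ) := by simpa using add_intCast_notMem_range ha 1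
  refine ((hasSum_mul_kummerCoeff ha hc t).add ((hasSum_kummerF ha hc t).mul_left a)).unique ?_
  convert! (hasSum_kummerF ha' hc t).mul_left a using 1
  funext n
  linear_combination -(t : ℂ) ^ n * mul_kummerCoeff_add_one a c n

theorem kummerF_sub_one_right {a c : ℂ} (ha : a ∉ Set.range ((↑·) : ℤ → ℂ))
    (hc : c ∉ Set.range ((↑·) : ℤ → ℂ)) (t : ℝ) :
    t * (a / c * kummerF (a + 1) (c + 1) t) + (c - 1) * kummerF a c t =
      (c - 1) * kummerF a (c - 1) t := by
  have hc' : c - 1 ∉ Set.range ((↑·) : ℤ → ℂ) := by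
    simpa [sub_eq_add_neg] using add_intCast_notMem_range hc (-1)
  refine ((hasSum_mul_kummerCoeff ha hc t).add
    ((hasSum_kummerF ha hc t).mul_left (c - 1))).unique ?_
  convert! (hasSum_kummerF ha hc' t).mul_left (c - 1) using 1
  funext n
  linear_combination -(t : ℂ) ^ n * mul_kummerCoeff_sub_one hc a n

/-- The seed function with the shifts absorbed in the parameters. -/
noncomputable def kummerSeed (c₁ c₂ a c : ℂ) (t : ℝ) : ℂ :=
  c₁ * (Complex.Gamma a * Complex.Gamma (c - a) / Complex.Gamma c) * kummerF a c t
  + c₂ * (1 / (Complex.sin ((π : ℂ) * (c - a)) * Complex.Gamma (2 - c))) *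
      ((t : ℂ) ^ (1 - c) * kummerF (a - c + 1) (2 - c) t)

theorem phiV_eq_kummerSeed (a c c₁ c₂ : ℂ) (i j : ℤ) :
    phiV a c c₁ c₂ i j = kummerSeed c₁ c₂ (a + i) (c + j) := by
  funext t
  rw [phiV, kummerSeed, show c - a - i + j = c + j - (a + i) by ring,
    show (2 : ℂ) - c - j = 2 - (c + j) by ring, show (1 : ℂ) - c - j = 1 - (c + j) by ring,
    show a - c + 1 + i - j = a + i - (c + j) + 1 by ring]

/-- The derivative of the seed function, before any use of contiguity relations. -/
noncomputable def kummerSeedDeriv (c₁ c₂ a c : ℂ) (t : ℝ) : ℂ :=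
  c₁ * (Complex.Gamma a * Complex.Gamma (c - a) / Complex.Gamma c) *
      (a / c * kummerF (a + 1) (c + 1) t)
  + c₂ * (1 / (Complex.sin ((π : ℂ) * (c - a)) * Complex.Gamma (2 - c))) *
      ((t : ℂ) ^ (-c) * ((1 - c) * kummerF (a - c + 1) (2 - c) t +
        t * ((a - c + 1) / (2 - c) * kummerF (a - c + 1 + 1) (2 - c + 1) t)))


theorem sub_add_one_notMem_range {a c : ℂ} (hca : c - a ∉ Set.range ((↑·) : ℤ → ℂ)) :
    a - c + 1 ∉ Set.range ((↑·) : ℤ → ℂ) := by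
  simpa using add_intCast_notMem_range (neg_notMem_range hca) 1

theorem two_sub_notMem_range {c : ℂ} (hc : c ∉ Set.range ((↑·) : ℤ → ℂ)) :
    2 - c ∉ Set.range ((↑·) : ℤ → ℂ) := by
  simpa [add_comm, sub_eq_add_neg] using add_intCast_notMem_range (neg_notMem_range hc) 2

theorem ofReal_cpow_one_sub (c : ℂ) {t : ℝ} (ht : 0 < t) :
    (t : ℂ) ^ (1 - c) = t * (t : ℂ) ^ (-c) := by
  rw [sub_eq_add_neg, Complex.cpow_add _ _ (by exact_mod_cast ht.ne'), Complex.cpow_one]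

theorem sin_pi_mul_sub_one (x : ℂ) :
    Complex.sin ((π : ℂ) * (x - 1)) = -Complex.sin ((π : ℂ) * x) := by
  rw [mul_sub, mul_one, Complex.sin_sub_pi]

theorem hasDerivAt_kummerSeed {a c : ℂ} (ha : a ∉ Set.range ((↑·) : ℤ → ℂ))
    (hc : c ∉ Set.range ((↑·) : ℤ → ℂ)) (hca : c - a ∉ Set.range ((↑·) : ℤ → ℂ)) (c₁ c₂ : ℂ)
    {t : ℝ} (ht : 0 < t) :
    HasDerivAt (kummerSeed c₁ c₂ a c) (kummerSeedDeriv c₁ c₂ a c t) t := by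
  have h1 := (hasDerivAt_kummerF ha hc t).const_mul
    (c₁ * (Complex.Gamma a * Complex.Gamma (c - a) / Complex.Gamma c))
  have h2 := hasDerivAt_kummerF (sub_add_one_notMem_range hca) (two_sub_notMem_range hc) t
  have h3 : HasDerivAt (fun s : ℝ => (s : ℂ) ^ (1 - c)) ((1 - c) * (t : ℂ) ^ (-c)) t := by
    have h := ((hasDerivAt_id (t : ℂ)).cpow_const (c := 1 - c)
      (Complex.ofReal_mem_slitPlane.2 ht)).comp_ofReal
    simpa using h
  convert! h1.add ((h3.mul h2).const_mul
    (c₂ * (1 / (Complex.sin ((π : ℂ) * (c - a)) * Complex.Gamma (2 - c))))) using 1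
  rw [kummerSeedDeriv, ofReal_cpow_one_sub c ht]
  ring

theorem kummerSeedDeriv_eq {a c : ℂ} (ha : a ∉ Set.range ((↑·) : ℤ → ℂ))
    (hc : c ∉ Set.range ((↑·) : ℤ → ℂ)) (hca : c - a ∉ Set.range ((↑·) : ℤ → ℂ)) (c₁ c₂ : ℂ)
    (t : ℝ) :
    kummerSeedDeriv c₁ c₂ a c t = kummerSeed c₁ c₂ (a + 1) (c + 1) t := by
  have hF := kummerF_sub_one_right (sub_add_one_notMem_range hca) (two_sub_notMem_range hc) t
  have hc1 : 1 - c ≠ 0 := by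
    simpa [add_comm, sub_eq_add_neg] using
      ne_zero_of_notMem_range (add_intCast_notMem_range (neg_notMem_range hc) 1)
  have e1 : 2 - c - 1 = 1 - c := by ring
  have hG := Complex.Gamma_add_one (1 - c) hc1
  rw [show 1 - c + 1 = 2 - c by ring] at hG
  rw [e1] at hF
  rw [kummerSeedDeriv, kummerSeed, add_sub_add_right_eq_sub,
    Complex.Gamma_add_one a (ne_zero_of_notMem_range ha),
    Complex.Gamma_add_one c (ne_zero_of_notMem_range hc), hG,
    show a + 1 - (c + 1) + 1 = a - c + 1 by ring, show 2 - (c + 1) = 1 - c by ring,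
    show 1 - (c + 1) = -c by ring, add_comm ((1 - c) * _), hF]
  have h := ne_zero_of_notMem_range hc
  congr 1
  · rw [mul_assoc, mul_assoc c₁]
    congr 1
    field_simp
  · field_simp

theorem kummerSeed_add_one_left {a c : ℂ} (ha : a ∉ Set.range ((↑·) : ℤ → ℂ))
    (hc : c ∉ Set.range ((↑·) : ℤ → ℂ)) (hca : c - a ∉ Set.range ((↑·) : ℤ → ℂ)) (c₁ c₂ : ℂ)
    {t : ℝ} (ht : 0 < t) :
    t * kummerSeedDeriv c₁ c₂ a c t + a * kummerSeed c₁ c₂ a c t =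
      (c - a - 1) * kummerSeed c₁ c₂ (a + 1) c t := by
  have hF := kummerF_add_one_left ha hc t
  have hF' := kummerF_add_one_left (sub_add_one_notMem_range hca) (two_sub_notMem_range hc) t
  have hca1 : c - a - 1 ≠ 0 := by
    simpa [sub_eq_add_neg] using
      ne_zero_of_notMem_range (add_intCast_notMem_range hca (-1))
  have hG := Complex.Gamma_add_one (c - a - 1) hca1
  rw [sub_add_cancel] at hG
  rw [kummerSeedDeriv, kummerSeed, kummerSeed, Complex.Gamma_add_one a (ne_zero_of_notMem_range ha),
    hG, show c - (a + 1) = c - a - 1 by ring, sin_pi_mul_sub_one, ofReal_cpow_one_sub c ht,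
    show a + 1 - c + 1 = a - c + 1 + 1 by ring]
  generalize Complex.sin ((π : ℂ) * (c - a)) = S
  linear_combination c₁ * (Complex.Gamma a * ((c - a - 1) * Complex.Gamma (c - a - 1)) /
    Complex.Gamma c) * hF + c₂ * (1 / (S * Complex.Gamma (2 - c))) * t * (t : ℂ) ^ (-c) * hF'

theorem kummerSeed_sub_one_right {a c : ℂ} (ha : a ∉ Set.range ((↑·) : ℤ → ℂ))
    (hc : c ∉ Set.range ((↑·) : ℤ → ℂ)) (hca : c - a ∉ Set.range ((↑·) : ℤ → ℂ)) (c₁ c₂ : ℂ)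
    {t : ℝ} (ht : 0 < t) :
    t * kummerSeedDeriv c₁ c₂ a c t + (c - 1) * kummerSeed c₁ c₂ a c t =
      (c - 1 - a) * kummerSeed c₁ c₂ a (c - 1) t := by
  have hF := kummerF_sub_one_right ha hc t
  have hca1 : c - a - 1 ≠ 0 := by
    simpa [sub_eq_add_neg] using
      ne_zero_of_notMem_range (add_intCast_notMem_range hca (-1))
  have hc1 : c - 1 ≠ 0 := by
    simpa [sub_eq_add_neg] using
      ne_zero_of_notMem_range (add_intCast_notMem_range hc (-1))
  have hc2 := ne_zero_of_notMem_range (two_sub_notMem_range hc)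
  have hG := Complex.Gamma_add_one (c - a - 1) hca1
  have hG1 := Complex.Gamma_add_one (c - 1) hc1
  have hG2 := Complex.Gamma_add_one (2 - c) hc2
  rw [sub_add_cancel] at hG hG1
  rw [kummerSeedDeriv, kummerSeed, kummerSeed, hG, hG1, show c - 1 - a = c - a - 1 by ring,
    show 2 - (c - 1) = 2 - c + 1 by ring, hG2, sin_pi_mul_sub_one, ofReal_cpow_one_sub (c - 1) ht,
    show -(c - 1) = 1 - c by ring, ofReal_cpow_one_sub c ht,
    show a - (c - 1) + 1 = a - c + 1 + 1 by ring]
  generalize Complex.sin ((π : ℂ) * (c - a)) = S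
  have e : (c - a - 1) * (c₁ * (Complex.Gamma a * Complex.Gamma (c - a - 1) /
      Complex.Gamma (c - 1)) * kummerF a (c - 1) t) =
      c₁ * (Complex.Gamma a * ((c - a - 1) * Complex.Gamma (c - a - 1)) /
      ((c - 1) * Complex.Gamma (c - 1))) * ((c - 1) * kummerF a (c - 1) t) := by
    field_simp
  have e' : 1 / (-S * ((2 - c) * Complex.Gamma (2 - c))) =
      -(1 / (S * Complex.Gamma (2 - c))) * (2 - c)⁻¹ := by
    simp only [one_div, mul_inv, inv_neg]
    ring
  rw [mul_add (c - a - 1), e, ← hF, e']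
  ring


theorem contDiffOn_kummerSeed {a c : ℂ} (ha : a ∉ Set.range ((↑·) : ℤ → ℂ))
    (hc : c ∉ Set.range ((↑·) : ℤ → ℂ)) (hca : c - a ∉ Set.range ((↑·) : ℤ → ℂ)) (c₁ c₂ : ℂ) :
    ContDiffOn ℝ (⊤ : ℕ∞) (kummerSeed c₁ c₂ a c) (Set.Ioi 0) := by
  refine contDiffOn_infty.2 fun n => ?_
  induction n generalizing a c with
  | zero =>
    exact contDiffOn_zero.2 fun t ht =>
      (hasDerivAt_kummerSeed ha hc hca c₁ c₂ ht).continuousAt.continuousWithinAt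
  | succ n ih =>
    have ha' : a + 1 ∉ Set.range ((↑·) : ℤ → ℂ) := by simpa using add_intCast_notMem_range ha 1
    have hc' : c + 1 ∉ Set.range ((↑·) : ℤ → ℂ) := by simpa using add_intCast_notMem_range hc 1
    push_cast
    rw [contDiffOn_succ_iff_deriv_of_isOpen isOpen_Ioi]
    refine ⟨fun t ht => (hasDerivAt_kummerSeed ha hc hca c₁ c₂
      ht).differentiableAt.differentiableWithinAt, by simp, ?_⟩
    refine (ih ha' hc' (by simpa using hca)).congr fun t ht => ?_
    rw [(hasDerivAt_kummerSeed ha hc hca c₁ c₂ ht).deriv, kummerSeedDeriv_eq ha hc hca]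

/-- The sequence of iterated Euler derivatives. -/
noncomputable def eulerJet (f : ℝ → ℂ) (t : ℝ) : ℕ → ℂ := fun k => eulerD^[k] f t

theorem ContDiffOn.eulerD_iterate {f : ℝ → ℂ} (hf : ContDiffOn ℝ (⊤ : ℕ∞) f (Set.Ioi 0)) (k : ℕ) :
    ContDiffOn ℝ (⊤ : ℕ∞) (eulerD^[k] f) (Set.Ioi 0) := by
  induction k with
  | zero => exact hf
  | succ k ih =>
    rw [Function.iterate_succ_apply']
    exact Complex.ofRealCLM.contDiff.contDiffOn.mul
      ((contDiffOn_infty_iff_deriv_of_isOpen isOpen_Ioi).1 ih).2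

theorem hasDerivAt_eulerJet {f : ℝ → ℂ} (hf : ContDiffOn ℝ (⊤ : ℕ∞) f (Set.Ioi 0)) {t : ℝ}
    (ht : 0 < t) (k : ℕ) :
    HasDerivAt (fun s => eulerJet f s k) ((t : ℂ)⁻¹ * eulerJet f t (k + 1)) t := by
  have h : DifferentiableAt ℝ (eulerD^[k] f) t :=
    ((hf.eulerD_iterate k).differentiableOn (by simp)).differentiableAt (Ioi_mem_nhds ht)
  convert! h.hasDerivAt using 1
  rw [eulerJet, Function.iterate_succ_apply', eulerD,
    inv_mul_cancel_left₀ (by exact_mod_cast ht.ne')]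

theorem christoffel_eulerJet {f g : ℝ → ℂ} {α κ : ℂ}
    (hf : ContDiffOn ℝ (⊤ : ℕ∞) f (Set.Ioi 0)) (hg : ContDiffOn ℝ (⊤ : ℕ∞) g (Set.Ioi 0))
    (h : ∀ t > 0, eulerD f t + α * f t = κ * g t) {t : ℝ} (ht : 0 < t) :
    christoffel α (eulerJet f t) = fun k => κ * eulerJet g t k := by
  funext k
  induction k generalizing t with
  | zero => exact h t ht
  | succ k ih =>
    have h1 := (HasDerivAt.christoffel (hasDerivAt_eulerJet hf ht) α k).congr_of_eventuallyEq
      (f₁ := fun s => κ * eulerJet g s k)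
      (by filter_upwards [Ioi_mem_nhds ht] with s hs using (ih hs).symm)
    have h2 := h1.unique ((hasDerivAt_eulerJet hg ht k).const_mul κ)
    refine mul_left_cancel₀ (inv_ne_zero (by exact_mod_cast ht.ne' : (t : ℂ) ≠ 0)) ?_
    rw [h2]
    ring

theorem eulerD_congr {f g : ℝ → ℂ} (h : ∀ t > 0, f t = g t) {t : ℝ} (ht : 0 < t) :
    eulerD f t = eulerD g t := by
  rw [eulerD, eulerD, Filter.EventuallyEq.deriv_eq (f := g)]
  filter_upwards [Ioi_mem_nhds ht] with s hs using h s hs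

theorem eulerJet_succ_of_eulerD_eq {f g : ℝ → ℂ} (hg : ContDiffOn ℝ (⊤ : ℕ∞) g (Set.Ioi 0))
    (h : ∀ t > 0, eulerD f t = t * g t) {t : ℝ} (ht : 0 < t) (k : ℕ) :
    eulerJet f t (k + 1) =
      t * ∑ r ∈ Finset.range (k + 1), (k.choose r : ℂ) * eulerJet g t r := by
  induction k generalizing f g with
  | zero => simpa [eulerJet] using h t ht
  | succ k ih =>
    have hd : ContDiffOn ℝ (⊤ : ℕ∞) (eulerD g) (Set.Ioi 0) := hg.eulerD_iterate 1
    have hsucc (s : ℝ) (hs : 0 < s) : eulerD (eulerD f) s = s * (g + eulerD g) s := by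
      have hs' : (s : ℂ) ≠ 0 := by exact_mod_cast hs.ne'
      have hprod := ((hasDerivAt_id s).ofReal_comp.mul (hasDerivAt_eulerJet hg hs 0)).deriv
      rw [eulerD_congr h hs, eulerD]
      refine (congrArg ((s : ℂ) * ·) hprod).trans ?_
      simp [eulerJet, mul_inv_cancel_left₀ hs']
    have hadd (r : ℕ) (s : ℝ) (hs : 0 < s) :
        eulerJet (g + eulerD g) s r = eulerJet g s r + eulerJet g s (r + 1) := by
      have := congrFun (christoffel_eulerJet (κ := 1) (α := 1) hg (hg.add hd)
        (fun t _ => by simp [add_comm]) hs) r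
      rw [one_mul] at this
      exact this.symm.trans (by rw [christoffel, one_mul, add_comm])
    have h1 := ih (g := g + eulerD g) (hg.add hd) hsucc
    rw [eulerJet, Function.iterate_succ_apply]
    refine h1.trans ?_
    congr 1
    rw [Finset.sum_choose_succ_mul (fun i _ => eulerJet g t i) k, ← Finset.sum_add_distrib]
    exact Finset.sum_congr rfl fun r _ => by rw [hadd r t ht, mul_add]

theorem hankelDet_christoffel_zero_eulerJet {f g : ℝ → ℂ}
    (hg : ContDiffOn ℝ (⊤ : ℕ∞) g (Set.Ioi 0)) (h : ∀ t > 0, eulerD f t = t * g t) {t : ℝ}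
    (ht : 0 < t) (N : ℕ) :
    hankelDet N (christoffel 0 (eulerJet f t)) = (t : ℂ) ^ N * hankelDet N (eulerJet g t) := by
  rw [← hankelDet_binomial N (eulerJet g t), ← hankelDet_const_mul]
  congr 1
  funext k
  rw [christoffel, zero_mul, add_zero, eulerJet_succ_of_eulerD_eq hg h ht]

theorem christoffel_const_mul (α κ : ℂ) (m : ℕ → ℂ) :
    christoffel α (fun k => κ * m k) = fun k => κ * christoffel α m k := by
  funext k
  simp only [christoffel]
  ring

theorem tauV_natCast (a c c₁ c₂ : ℂ) (i j : ℤ) (N : ℕ) (t : ℝ) :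
    tauV a c c₁ c₂ i j N t = hankelDet N (eulerJet (kummerSeed c₁ c₂ (a + i) (c + j)) t) := by
  rw [tauV, if_neg (by simp), phiV_eq_kummerSeed]
  rfl

theorem eulerD_kummerSeed {a c : ℂ} (ha : a ∉ Set.range ((↑·) : ℤ → ℂ))
    (hc : c ∉ Set.range ((↑·) : ℤ → ℂ)) (hca : c - a ∉ Set.range ((↑·) : ℤ → ℂ)) (c₁ c₂ : ℂ)
    {t : ℝ} (ht : 0 < t) :
    eulerD (kummerSeed c₁ c₂ a c) t = t * kummerSeedDeriv c₁ c₂ a c t := by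
  rw [eulerD, (hasDerivAt_kummerSeed ha hc hca c₁ c₂ ht).deriv]

theorem hankelDet_eulerJet_kummerSeed {a c : ℂ} (ha : a ∉ Set.range ((↑·) : ℤ → ℂ))
    (hc : c ∉ Set.range ((↑·) : ℤ → ℂ)) (hca : c - a ∉ Set.range ((↑·) : ℤ → ℂ)) (c₁ c₂ : ℂ)
    {t : ℝ} (ht : 0 < t) (N : ℕ) :
    let m := eulerJet (kummerSeed c₁ c₂ a (c + 1)) t
    hankelDet N (christoffel c m) =
        (c - a) ^ N * hankelDet N (eulerJet (kummerSeed c₁ c₂ a c) t) ∧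
      hankelDet N (christoffel a m) =
        (c - a) ^ N * hankelDet N (eulerJet (kummerSeed c₁ c₂ (a + 1) (c + 1)) t) ∧
      hankelDet N (christoffel a (christoffel c m)) =
        ((c - a) * (c - a - 1)) ^ N * hankelDet N (eulerJet (kummerSeed c₁ c₂ (a + 1) c) t) ∧
      hankelDet N (christoffel 0 (christoffel c m)) =
        (t : ℂ) ^ N * hankelDet N (christoffel a m) ∧
      hankelDet N (christoffel 0 (christoffel a (christoffel c m))) =
        (t : ℂ) ^ N * (((c - a) * (c - a - 1)) ^ N *
          hankelDet N (eulerJet (kummerSeed c₁ c₂ (a + 1 + 1) (c + 1)) t)) := by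
  intro m
  have ha' : a + 1 ∉ Set.range ((↑·) : ℤ → ℂ) := by simpa using add_intCast_notMem_range ha 1
  have ha'' : a + 1 + 1 ∉ Set.range ((↑·) : ℤ → ℂ) := by simpa using add_intCast_notMem_range ha' 1
  have hc' : c + 1 ∉ Set.range ((↑·) : ℤ → ℂ) := by simpa using add_intCast_notMem_range hc 1
  have h01 : c + 1 - a ∉ Set.range ((↑·) : ℤ → ℂ) := by
    simpa [add_sub_right_comm] using add_intCast_notMem_range hca 1
  have h11 : c + 1 - (a + 1) ∉ Set.range ((↑·) : ℤ → ℂ) := by simpa using hca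
  have h10 : c - (a + 1) ∉ Set.range ((↑·) : ℤ → ℂ) := by
    simpa [sub_eq_add_neg, add_assoc, add_comm, add_left_comm] using
      add_intCast_notMem_range hca (-1)
  have s01 := contDiffOn_kummerSeed ha hc' h01 c₁ c₂
  have s00 := contDiffOn_kummerSeed ha hc hca c₁ c₂
  have s11 := contDiffOn_kummerSeed ha' hc' h11 c₁ c₂
  have s10 := contDiffOn_kummerSeed ha' hc h10 c₁ c₂
  have s21 := contDiffOn_kummerSeed ha'' hc' (by simpa using h10) c₁ c₂
  have e00 : christoffel c m = fun k => (c - a) * eulerJet (kummerSeed c₁ c₂ a c) t k := by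
    refine christoffel_eulerJet s01 s00 (fun s hs => ?_) ht
    have h := kummerSeed_sub_one_right ha hc' h01 c₁ c₂ hs
    rw [add_sub_cancel_right] at h
    rw [eulerD_kummerSeed ha hc' h01 c₁ c₂ hs, h]
  have e11 : christoffel a m =
      fun k => (c - a) * eulerJet (kummerSeed c₁ c₂ (a + 1) (c + 1)) t k := by
    refine christoffel_eulerJet s01 s11 (fun s hs => ?_) ht
    rw [eulerD_kummerSeed ha hc' h01 c₁ c₂ hs, kummerSeed_add_one_left ha hc' h01 c₁ c₂ hs]
    ring
  have e10 : christoffel a (eulerJet (kummerSeed c₁ c₂ a c) t) =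
      fun k => (c - a - 1) * eulerJet (kummerSeed c₁ c₂ (a + 1) c) t k := by
    refine christoffel_eulerJet s00 s10 (fun s hs => ?_) ht
    rw [eulerD_kummerSeed ha hc hca c₁ c₂ hs, kummerSeed_add_one_left ha hc hca c₁ c₂ hs]
  have z00 := hankelDet_christoffel_zero_eulerJet (f := kummerSeed c₁ c₂ a c) s11
    (fun s hs => by rw [eulerD_kummerSeed ha hc hca c₁ c₂ hs, kummerSeedDeriv_eq ha hc hca]) ht N
  have z10 := hankelDet_christoffel_zero_eulerJet (f := kummerSeed c₁ c₂ (a + 1) c) s21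
    (fun s hs => by rw [eulerD_kummerSeed ha' hc h10 c₁ c₂ hs, kummerSeedDeriv_eq ha' hc h10]) ht N
  simp only [e00, e11, e10, christoffel_const_mul, hankelDet_const_mul, z00, z10, mul_pow]
  refine ⟨trivial, trivial, ?_, ?_, ?_⟩ <;> ring

/-- determinant formula for a family of classical transcendental
solutions of the Hamiltonian system S_V with parameters
`κ∞ = a+n`, `κ₀ = c-a`, `θ = -c+n`. -/
theorem pV_hamiltonian_det_solution
    (a c c₁ c₂ : ℂ)
    (ha : a ∉ Set.range ((↑·) : ℤ → ℂ))
    (hc : c ∉ Set.range ((↑·) : ℤ → ℂ))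
    (hca : c - a ∉ Set.range ((↑·) : ℤ → ℂ))
    (n : ℕ) (U : Set ℝ) (hU : IsOpen U) (hU0 : U ⊆ Set.Ioi 0)
    (hden1 : ∀ t ∈ U, tauV a c c₁ c₂ 0 0 n t ≠ 0)
    (hden2 : ∀ t ∈ U, tauV a c c₁ c₂ 1 1 (n + 1) t ≠ 0)
    (hden3 : ∀ t ∈ U, tauV a c c₁ c₂ 1 1 n t ≠ 0)
    (hden4 : ∀ t ∈ U, tauV a c c₁ c₂ 1 0 n t ≠ 0)
    (q p : ℝ → ℂ)
    (hq : ∀ t, q t = -(((c - a - 1) / (c - a)) ^ n *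
      (tauV a c c₁ c₂ 1 0 n t * tauV a c c₁ c₂ 0 1 (n + 1) t) /
      (tauV a c c₁ c₂ 0 0 n t * tauV a c c₁ c₂ 1 1 (n + 1) t)))
    (hp : ∀ t, p t = -((a / (c - a - 1)) * (t : ℂ)⁻¹ *
      (tauV a c c₁ c₂ 0 0 n t * tauV a c c₁ c₂ 1 1 (n + 1) t *
        tauV a c c₁ c₂ 2 1 (n - 1) t) /
      ((tauV a c c₁ c₂ 1 1 n t) ^ 2 * tauV a c c₁ c₂ 1 0 n t))) :
    ∀ t ∈ U,
      (t : ℂ) * deriv q t =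
        2 * q t * (q t - 1) ^ 2 * p t
          - ((c - a) * (q t - 1) ^ 2 + (-c + n) * q t * (q t - 1) + (t : ℂ) * q t) ∧
      (t : ℂ) * deriv p t =
        -(((q t - 1) ^ 2 + 2 * q t * (q t - 1)) * (p t) ^ 2
            - (2 * (c - a) * (q t - 1) + (-c + n) * (2 * q t - 1) + (t : ℂ)) * p t
            + ((1 / 4) * ((c - a) + (-c + n)) ^ 2 - (1 / 4) * (a + n) ^ 2)) := by
  have hX : c - a ≠ 0 := ne_zero_of_notMem_range hca
  have hY : c - a - 1 ≠ 0 := by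
    simpa [sub_eq_add_neg] using ne_zero_of_notMem_range (add_intCast_notMem_range hca (-1))
  have hc' : c + 1 ∉ Set.range ((↑·) : ℤ → ℂ) := by simpa using add_intCast_notMem_range hc 1
  have h01 : c + 1 - a ∉ Set.range ((↑·) : ℤ → ℂ) := by
    simpa [add_sub_right_comm] using add_intCast_notMem_range hca 1
  set m : ℝ → ℕ → ℂ := eulerJet (kummerSeed c₁ c₂ a (c + 1)) with hm
  have t00 (N : ℕ) (s : ℝ) : tauV a c c₁ c₂ 0 0 N s =
      hankelDet N (eulerJet (kummerSeed c₁ c₂ a c) s) := by simp [tauV_natCast]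
  have t11 (N : ℕ) (s : ℝ) : tauV a c c₁ c₂ 1 1 N s =
      hankelDet N (eulerJet (kummerSeed c₁ c₂ (a + 1) (c + 1)) s) := by simp [tauV_natCast]
  have t10 (N : ℕ) (s : ℝ) : tauV a c c₁ c₂ 1 0 N s =
      hankelDet N (eulerJet (kummerSeed c₁ c₂ (a + 1) c) s) := by simp [tauV_natCast]
  have t01 (N : ℕ) (s : ℝ) : tauV a c c₁ c₂ 0 1 N s = hankelDet N (m s) := by
    simp [tauV_natCast, hm]
  have t21 (N : ℕ) (s : ℝ) : tauV a c c₁ c₂ 2 1 N s =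
      hankelDet N (eulerJet (kummerSeed c₁ c₂ (a + 1 + 1) (c + 1)) s) := by
    rw [tauV_natCast, show a + ((2 : ℤ) : ℂ) = a + 1 + 1 by push_cast; ring, Int.cast_one]
  have key (s : ℝ) (hs : 0 < s) (N : ℕ) := hankelDet_eulerJet_kummerSeed ha hc hca c₁ c₂ hs N
  simp only [← hm, ← t00, ← t11, ← t10, ← t21] at key
  have hne (s : ℝ) (hs : s ∈ U) : hankelDet n (christoffel a (m s)) ≠ 0 ∧
      hankelDet (n + 1) (christoffel a (m s)) ≠ 0 ∧ hankelDet n (christoffel c (m s)) ≠ 0 ∧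
      hankelDet n (christoffel a (christoffel c (m s))) ≠ 0 := by
    have hs0 : 0 < s := hU0 hs
    obtain ⟨k1, k2, k3, -, -⟩ := key s hs0 n
    have k4 := (key s hs0 (n + 1)).2.1
    rw [k1, k2, k3, k4]
    exact ⟨mul_ne_zero (pow_ne_zero _ hX) (hden3 s hs),
      mul_ne_zero (pow_ne_zero _ hX) (by exact_mod_cast hden2 s hs),
      mul_ne_zero (pow_ne_zero _ hX) (hden1 s hs),
      mul_ne_zero (pow_ne_zero _ (mul_ne_zero hX hY)) (hden4 s hs)⟩
  set q' : ℝ → ℂ := fun s =>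
    1 - hankelDet n (christoffel a (m s)) * hankelDet (n + 1) (christoffel c (m s)) /
      (hankelDet n (christoffel c (m s)) * hankelDet (n + 1) (christoffel a (m s))) with hq'
  set p' : ℝ → ℂ := fun s => hankelDet (n + 1) (christoffel a (m s)) *
        hankelDetPred n (christoffel a (christoffel c (m s))) /
        (hankelDet n (christoffel a (m s)) * hankelDet n (christoffel a (christoffel c (m s)))) -
      hankelDet (n + 1) (christoffel a (m s)) * hankelDetPred n (christoffel a (m s)) /
        ((s : ℂ) * hankelDet n (christoffel a (m s)) ^ 2) with hp'
  have hqq (s : ℝ) (hs : s ∈ U) : q s = q' s := by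
    have hs0 : 0 < s := hU0 hs
    obtain ⟨n2, n4, n1, n3⟩ := hne s hs
    obtain ⟨k1, k2, k3, -, -⟩ := key s hs0 n
    have k4 := (key s hs0 (n + 1)).2.1
    have hpl := hankelDet_christoffel_christoffel n (m s) a c
    have d1 := hden1 s hs
    have d2 := hden2 s hs
    have e1 : q' s = -((c - a) * hankelDet (n + 1) (m s) *
        hankelDet n (christoffel a (christoffel c (m s))) /
        (hankelDet n (christoffel c (m s)) * hankelDet (n + 1) (christoffel a (m s)))) := by
      rw [hpl, hq']
      field_simp
      ring
    rw [e1, hq, k3, k1, k4, ← t01, div_pow, mul_pow]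
    push_cast
    field_simp
    ring
  have hpp (s : ℝ) (hs : s ∈ U) : p s = p' s := by
    have hs0 : 0 < s := hU0 hs
    have hsC : (s : ℂ) ≠ 0 := by exact_mod_cast hs0.ne'
    obtain ⟨n2, n4, n1, n3⟩ := hne s hs
    obtain ⟨k1, k2, k3, k5, -⟩ := key s hs0 n
    have k4 := (key s hs0 (n + 1)).2.1
    have d1 := hden1 s hs
    have d3 := hden3 s hs
    have d4 := hden4 s hs
    rw [hp]
    cases n with
    | zero => simp [hp', hankelDetPred, tauV]
    | succ N =>
      obtain ⟨-, -, -, k6, k7⟩ := key s hs0 N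
      have hpl := hankelDet_christoffel_christoffel N (christoffel c (m s)) a 0
      rw [christoffel_comm a 0, k7, k6, k5] at hpl
      have e1 : p' s = -(a * hankelDet (N + 1 + 1) (christoffel a (m s)) *
          hankelDet (N + 1) (christoffel c (m s)) *
          (((c - a) * (c - a - 1)) ^ N * tauV a c c₁ c₂ 2 1 N s) /
          (s * hankelDet (N + 1) (christoffel a (m s)) ^ 2 *
            hankelDet (N + 1) (christoffel a (christoffel c (m s))))) := by
        simp only [hp', hankelDetPred]
        field_simp
        refine mul_left_cancel₀ (pow_ne_zero N hsC) ?_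
        linear_combination -hpl
      rw [e1, k1, k2, k3, k4, show ((N + 1 : ℕ) : ℤ) - 1 = N by push_cast; ring]
      push_cast at *
      field_simp
      ring
  intro t ht
  have ht0 : 0 < t := hU0 ht
  obtain ⟨n2, n4, n1, n3⟩ := hne t ht
  have hdq : deriv q t = deriv q' t := Filter.EventuallyEq.deriv_eq
    (by filter_upwards [hU.mem_nhds ht] with s hs using hqq s hs)
  have hdp : deriv p t = deriv p' t := Filter.EventuallyEq.deriv_eq
    (by filter_upwards [hU.mem_nhds ht] with s hs using hpp s hs)
  rw [hdq, hdp, hqq t ht, hpp t ht]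
  exact hasDerivAt_pV_of_hankelDet ht0
    (hasDerivAt_eulerJet (contDiffOn_kummerSeed ha hc' h01 c₁ c₂) ht0)
    (fun N s hs => (key s hs N).2.2.2.1) n2 n4 n1 n3 (fun _ => rfl) (fun _ => rfl)
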